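/- Let 0 ⊂ I ⊊ J ⊂ S be two monomial ideals and v ∈ S a monomial such that (I : v) ⊊ (J : v). Then slength((J : v)/(I : v)) ≤ slength(J/I). -/

import Mathlib

open MvPolynomial

/-- The set of exponent vectors of the monomials in the Stanley space `x^u · K[Z]`. -/
def stanleySet {σ : Type} (u : σ →₀ ℕ) (Z : Set σ) : Set (σ →₀ ℕ) :=
  {w | ∃ v : σ →₀ ℕ, ↑v.support ⊆ Z ∧ w = u + v}

/-- A Stanley decomposition (partition into Stanley spaces) of a set `P` of
exponent vectors of monomials.  By the standard correspondence, Stanley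
decompositions of a multigraded `K`-vector subquotient of `S` spanned by the
monomials with exponents in `P` correspond exactly to such partitions. -/
structure StanleyPartition {σ : Type} (P : Set (σ →₀ ℕ)) where
  r : ℕ
  base : Fin r → σ →₀ ℕ
  vars : Fin r → Set σ
  cover : P = ⋃ i, stanleySet (base i) (vars i)
  disj : ∀ i j, i ≠ j → Disjoint (stanleySet (base i) (vars i)) (stanleySet (base j) (vars j))

/-- The Stanley length of `P`: the minimal length of a Stanley decomposition. -/
noncomputable def slength {σ : Type} (P : Set (σ →₀ ℕ)) : ℕ :=
  sInf {r | ∃ D : StanleyPartition P, D.r = r}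

/-- The set of exponent vectors of the monomials belonging to an ideal. -/
def monSet {σ K : Type} [Field K] (I : Ideal (MvPolynomial σ K)) : Set (σ →₀ ℕ) :=
  {d | (monomial d (1 : K) : MvPolynomial σ K) ∈ I}

/-- `I` is a monomial ideal. -/
def IsMonomialIdeal {σ K : Type} [Field K] (I : Ideal (MvPolynomial σ K)) : Prop :=
  ∃ A : Set (σ →₀ ℕ), I = Ideal.span ((fun d => (monomial d (1 : K) : MvPolynomial σ K)) '' A)

/-- Exponent vectors of the minimal monomial generators of `I`. -/
def minGens {σ K : Type} [Field K] (I : Ideal (MvPolynomial σ K)) : Set (σ →₀ ℕ) :=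
  {d | d ∈ monSet I ∧ ∀ e ∈ monSet I, e ≤ d → e = d}

/-- A Stanley space in coordinates. -/
lemma mem_stanleySet_iff {σ : Type} (u w : σ →₀ ℕ) (Z : Set σ) :
    w ∈ stanleySet u Z ↔ u ≤ w ∧ ∀ i, i ∉ Z → w i = u i := by
  constructor
  · rintro ⟨t, ht, rfl⟩
    refine ⟨le_self_add, fun i hi => ?_⟩
    have : t i = 0 := by
      by_contra h
      exact hi (ht (by simpa using h))
    simp [this]
  · rintro ⟨hle, h⟩
    refine ⟨w - u, fun i hi => ?_, (add_tsub_cancel_of_le hle).symm⟩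
    by_contra hZ
    simp [h i hZ] at hi

/-- A finite partition into Stanley spaces, indexed by any finite type, is a Stanley partition. -/
lemma exists_stanleyPartition_of_finite {σ ι : Type} [Fintype ι] {P : Set (σ →₀ ℕ)}
    (base : ι → σ →₀ ℕ) (vars : ι → Set σ)
    (cover : ∀ w, w ∈ P ↔ ∃ i, w ∈ stanleySet (base i) (vars i))
    (disj : ∀ i j w, w ∈ stanleySet (base i) (vars i) → w ∈ stanleySet (base j) (vars j) → i = j) :
    ∃ D : StanleyPartition P, D.r = Fintype.card ι := by
  let e := (Fintype.equivFin ι).symm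
  refine ⟨⟨Fintype.card ι, base ∘ e, vars ∘ e, ?_, ?_⟩, rfl⟩
  · ext w
    rw [cover, Set.mem_iUnion]
    exact e.surjective.exists
  · intro i j hij
    rw [Set.disjoint_left]
    exact fun w hi hj => hij (e.injective (disj _ _ w hi hj))

/-- Membership in an upper set of exponent vectors is detected after truncating at a suitable
exponent vector. -/
lemma IsUpperSet.exists_inf_mem_iff {σ : Type} [Finite σ] {U : Set (σ →₀ ℕ)} (hU : IsUpperSet U) :
    ∃ N, ∀ M, N ≤ M → ∀ w, w ⊓ M ∈ U ↔ w ∈ U := by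
  have hfin : {m | Minimal (· ∈ U) m}.Finite :=
    (setOfPred_minimal_antichain (· ∈ U)).finite_of_partiallyWellOrderedOn
      (Set.isPWO_of_wellQuasiOrderedLE _)
  obtain ⟨N, hN⟩ := hfin.bddAbove
  refine ⟨N, fun M hM w => ⟨fun h => hU inf_le_left h, fun h => ?_⟩⟩
  obtain ⟨m, hmw, hm⟩ := exists_minimal_le_of_wellFoundedLT (· ∈ U) w h
  exact hU (le_inf hmw ((hN hm).trans hM)) hm.prop

/-- The difference of two upper sets of exponent vectors has a Stanley partition. -/
lemma exists_stanleyPartition_diff {σ : Type} [Finite σ] {U V : Set (σ →₀ ℕ)}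
    (hU : IsUpperSet U) (hV : IsUpperSet V) : Nonempty (StanleyPartition (U \ V)) := by
  classical
  obtain ⟨N₁, h₁⟩ := hU.exists_inf_mem_iff
  obtain ⟨N₂, h₂⟩ := hV.exists_inf_mem_iff
  set N := N₁ ⊔ N₂
  have hP : ∀ w, w ⊓ N ∈ U \ V ↔ w ∈ U \ V := fun w => by
    simp only [Set.mem_sdiff, h₁ N le_sup_left, h₂ N le_sup_right]
  have fiber : ∀ c ≤ N, ∀ w, w ∈ stanleySet c {i | c i = N i} ↔ w ⊓ N = c := by
    intro c hc w
    rw [mem_stanleySet_iff, Finsupp.ext_iff, Finsupp.le_def]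
    simp only [Finsupp.inf_apply, Set.mem_ofPred_eq, ← forall_and]
    refine forall_congr' fun i => ?_
    have := hc i
    omega
  have : Fintype ↥{c | c ≤ N ∧ c ∈ U \ V} :=
    ((Finset.Icc 0 N).finite_toSet.subset fun c hc => by simpa using hc.1).fintype
  refine (exists_stanleyPartition_of_finite
    (fun c : ↥{c | c ≤ N ∧ c ∈ U \ V} => c.1) (fun c => {i | c.1 i = N i})
    (fun w => ⟨fun hw => ⟨⟨w ⊓ N, inf_le_right, (hP w).2 hw⟩, (fiber _ inf_le_right w).2 rfl⟩, ?_⟩)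
    (fun c d w hc hd => Subtype.ext ?_)).nonempty
  · rintro ⟨⟨c, hcN, hc⟩, hw⟩
    rw [← hP w, (fiber c hcN w).1 hw]
    exact hc
  · rw [← (fiber _ c.2.1 w).1 hc, (fiber _ d.2.1 w).1 hd]

/-- The preimage of a Stanley space under multiplication by a monomial, if nonempty, is a Stanley
space. -/
lemma add_mem_stanleySet_iff {σ : Type} (u v w : σ →₀ ℕ) (Z : Set σ) :
    v + w ∈ stanleySet u Z ↔ (∀ i, i ∉ Z → v i ≤ u i) ∧ w ∈ stanleySet (u - v) Z := by
  simp only [mem_stanleySet_iff, Finsupp.le_def, Finsupp.add_apply, Finsupp.tsub_apply,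
    ← forall_and]
  refine forall_congr' fun i => ?_
  by_cases h : i ∈ Z
  · simp only [h, not_true, false_imp_iff, and_true, true_and]
    omega
  · simp only [h, not_false_eq_true, forall_const]
    omega

/-- A Stanley partition of `P` induces one of the preimage of `P` under translation, of no larger
length. -/
lemma StanleyPartition.exists_preimage_add {σ : Type} {P : Set (σ →₀ ℕ)} (D : StanleyPartition P)
    (v : σ →₀ ℕ) : ∃ E : StanleyPartition ((v + ·) ⁻¹' P), E.r ≤ D.r := by
  classical
  refine (exists_stanleyPartition_of_finite
    (fun k : {k : Fin D.r // ∀ i, i ∉ D.vars k → v i ≤ D.base k i} => D.base k - v)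
    (fun k => D.vars k) (fun w => ?_) (fun k l w hk hl => ?_)).imp
    fun E hE => hE.trans_le ((Fintype.card_subtype_le _).trans_eq (Fintype.card_fin _))
  · conv_lhs => rw [D.cover]
    simp only [Set.mem_preimage, Set.mem_iUnion, add_mem_stanleySet_iff, Subtype.exists, exists_prop]
  · by_contra hkl
    exact Set.disjoint_left.1 (D.disj k l fun h => hkl (Subtype.ext h))
      ((add_mem_stanleySet_iff _ v w _).2 ⟨k.2, hk⟩) ((add_mem_stanleySet_iff _ v w _).2 ⟨l.2, hl⟩)

lemma slength_preimage_add_le {σ : Type} {P : Set (σ →₀ ℕ)} (hP : Nonempty (StanleyPartition P))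
    (v : σ →₀ ℕ) : slength ((v + ·) ⁻¹' P) ≤ slength P := by
  obtain ⟨D, hD⟩ : ∃ D : StanleyPartition P, D.r = slength P :=
    Nat.sInf_mem (s := {r | ∃ D : StanleyPartition P, D.r = r}) (hP.elim fun D => ⟨D.r, D, rfl⟩)
  obtain ⟨E, hE⟩ := D.exists_preimage_add v
  have hle : slength ((v + ·) ⁻¹' P) ≤ E.r := by
    apply Nat.sInf_le
    exact ⟨E, rfl⟩
  exact hle.trans (hE.trans_eq hD)

lemma isUpperSet_monSet {σ K : Type} [Field K] (I : Ideal (MvPolynomial σ K)) :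
    IsUpperSet (monSet I) := by
  intro a b hab ha
  have := I.mul_mem_left (monomial (b - a) (1 : K)) ha
  rwa [monomial_mul, tsub_add_cancel_of_le hab, one_mul] at this

lemma monSet_colon_monomial {σ K : Type} [Field K] (I : Ideal (MvPolynomial σ K)) (v : σ →₀ ℕ) :
    monSet (Submodule.colon I (Ideal.span {(monomial v (1 : K) : MvPolynomial σ K)})) =
      (v + ·) ⁻¹' monSet I := by
  ext d
  simp only [monSet, Set.mem_ofPred_eq, Set.mem_preimage, Ideal.mem_colon_span_singleton]
  rw [monomial_mul, add_comm, one_mul]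

/-- If `0 ⊂ I ⊊ J` are monomial ideals and `v` a monomial with
`(I : v) ⊊ (J : v)`, then `slength((J : v)/(I : v)) ≤ slength(J/I)`. -/
theorem stmt_9 {K : Type} [Field K] {n : ℕ} (I J : Ideal (MvPolynomial (Fin n) K))
    (hmonI : IsMonomialIdeal I) (hmonJ : IsMonomialIdeal J)
    (hI : I ≠ ⊥) (hIJ : I < J) (v : Fin n →₀ ℕ)
    (hcolon : Submodule.colon I (Ideal.span {(monomial v (1 : K) : MvPolynomial (Fin n) K)}) <
      Submodule.colon J (Ideal.span {(monomial v (1 : K) : MvPolynomial (Fin n) K)})) :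
    slength (monSet (Submodule.colon J
        (Ideal.span {(monomial v (1 : K) : MvPolynomial (Fin n) K)})) \
      monSet (Submodule.colon I
        (Ideal.span {(monomial v (1 : K) : MvPolynomial (Fin n) K)}))) ≤
    slength (monSet J \ monSet I) := by
  rw [monSet_colon_monomial, monSet_colon_monomial, ← Set.preimage_sdiff]
  exact slength_preimage_add_le
    (exists_stanleyPartition_diff (isUpperSet_monSet J) (isUpperSet_monSet I)) v
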